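/- If κ is an infinite cardinal with 2^κ < ℵ_κ and cf(κ) > ω, then there exists a compact Hausdorff topological space X such that o(X) = 2^(ℵ_κ) = |X|, ℵ_κ is a caliber* for X, ℵ_κ is not a weak precaliber for X, and κ is not a weak precaliber* for X. -/

import Mathlib

open Cardinal Set

universe u

/-- `κ` is a caliber for `X`: every κ-indexed family of non-empty open sets
(repetitions allowed) has a κ-sized subfamily with non-empty intersection. -/
def IsCaliber (X : Type u) [TopologicalSpace X] (κ : Cardinal.{u}) : Prop :=
  ∀ {ι : Type u} (U : ι → Set X), #ι = κ → (∀ i, IsOpen (U i)) → (∀ i, (U i).Nonempty) →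
    ∃ J : Set ι, #J = κ ∧ (⋂ i ∈ J, U i).Nonempty

/-- `κ` is a precaliber for `X`: every κ-indexed family of non-empty open sets
has a κ-sized subfamily which is centered. -/
def IsPrecaliber (X : Type u) [TopologicalSpace X] (κ : Cardinal.{u}) : Prop :=
  ∀ {ι : Type u} (U : ι → Set X), #ι = κ → (∀ i, IsOpen (U i)) → (∀ i, (U i).Nonempty) →
    ∃ J : Set ι, #J = κ ∧
      ∀ s : Finset ι, ↑s ⊆ J → s.Nonempty → (⋂ i ∈ s, U i).Nonempty

/-- `κ` is a weak precaliber for `X`: every κ-indexed family of non-empty open sets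
has a κ-sized subfamily which is linked. -/
def IsWeakPrecaliber (X : Type u) [TopologicalSpace X] (κ : Cardinal.{u}) : Prop :=
  ∀ {ι : Type u} (U : ι → Set X), #ι = κ → (∀ i, IsOpen (U i)) → (∀ i, (U i).Nonempty) →
    ∃ J : Set ι, #J = κ ∧ ∀ i ∈ J, ∀ j ∈ J, (U i ∩ U j).Nonempty

/-- `κ` is a caliber* for `X`: every family of non-empty open sets of cardinality `κ`
has a subfamily of cardinality `κ` with non-empty intersection. -/
def IsCaliberStar (X : Type u) [TopologicalSpace X] (κ : Cardinal.{u}) : Prop :=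
  ∀ 𝒰 : Set (Set X), #𝒰 = κ → (∀ U ∈ 𝒰, IsOpen U) → (∀ U ∈ 𝒰, U.Nonempty) →
    ∃ 𝒱 ⊆ 𝒰, #𝒱 = κ ∧ (⋂₀ 𝒱).Nonempty

/-- `κ` is a precaliber* for `X`: every family of non-empty open sets of cardinality `κ`
has a centered subfamily of cardinality `κ`. -/
def IsPrecaliberStar (X : Type u) [TopologicalSpace X] (κ : Cardinal.{u}) : Prop :=
  ∀ 𝒰 : Set (Set X), #𝒰 = κ → (∀ U ∈ 𝒰, IsOpen U) → (∀ U ∈ 𝒰, U.Nonempty) →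
    ∃ 𝒱 ⊆ 𝒰, #𝒱 = κ ∧
      ∀ s : Finset (Set X), ↑s ⊆ 𝒱 → s.Nonempty → (⋂₀ (↑s : Set (Set X))).Nonempty

/-- `κ` is a weak precaliber* for `X`: every family of non-empty open sets of
cardinality `κ` has a linked subfamily of cardinality `κ`. -/
def IsWeakPrecaliberStar (X : Type u) [TopologicalSpace X] (κ : Cardinal.{u}) : Prop :=
  ∀ 𝒰 : Set (Set X), #𝒰 = κ → (∀ U ∈ 𝒰, IsOpen U) → (∀ U ∈ 𝒰, U.Nonempty) →
    ∃ 𝒱 ⊆ 𝒰, #𝒱 = κ ∧ ∀ U ∈ 𝒱, ∀ V ∈ 𝒱, (U ∩ V).Nonempty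

/-- `o X` : the number of open subsets of `X`. -/
def oCard (X : Type u) [TopologicalSpace X] : Cardinal.{u} :=
  #{U : Set X | IsOpen U}

/-- A cellular family: a pairwise disjoint collection of non-empty open sets. -/
def IsCellularFamily (X : Type u) [TopologicalSpace X] (𝒰 : Set (Set X)) : Prop :=
  (∀ U ∈ 𝒰, IsOpen U) ∧ (∀ U ∈ 𝒰, U.Nonempty) ∧ 𝒰.Pairwise Disjoint


/-- A family of sets in which every subfamily of size less than `θ` can be extended by a new
index whose set is disjoint from the chosen ones has a pairwise disjoint subfamily of size `θ`. -/
theorem exists_pairwiseDisjoint_of_extend {ι Λ : Type u} (G : ι → Set Λ) (J : Set ι)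
    (θ : Cardinal.{u})
    (h : ∀ M ⊆ J, #M < θ → ∃ α ∈ J, α ∉ M ∧ ∀ β ∈ M, Disjoint (G α) (G β)) :
    ∃ M ⊆ J, θ ≤ #M ∧ M.PairwiseDisjoint G := by
  obtain ⟨M, hM⟩ := zorn_subset {M : Set ι | M ⊆ J ∧ M.PairwiseDisjoint G} (by
    intro C hC hchain
    refine ⟨⋃₀ C, ⟨sUnion_subset fun s hs => (hC hs).1, ?_⟩, fun s hs => subset_sUnion_of_mem hs⟩
    exact (pairwiseDisjoint_sUnion hchain.directedOn).2 fun s hs => (hC hs).2)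
  refine ⟨M, hM.prop.1, ?_, hM.prop.2⟩
  by_contra! hlt
  obtain ⟨α, hαJ, hαM, hα⟩ := h M hM.prop.1 hlt
  refine hαM (hM.le_of_ge (y := insert α M) ⟨insert_subset hαJ hM.prop.1, ?_⟩
    (subset_insert α M) (mem_insert α M))
  exact hM.prop.2.insert fun β hβ _ => hα β hβ

/-- Among at least `θ` many finite partial functions with domains of bounded size, at least `θ`
many extend a common finite partial function whose domain `R` is maximal, in the sense that no
further coordinate is shared by `θ` many of them. -/
theorem exists_root {ι Λ : Type u} (F : ι → Finset Λ) (f : ι → Λ → Bool) (n : ℕ)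
    (hF : ∀ α, (F α).card ≤ n) (s : Set ι) {θ : Cardinal.{u}} (hθ : θ.IsRegular) (hs : θ ≤ #s) :
    ∃ (R : Finset Λ) (g : Λ → Bool), ∃ J ⊆ s, θ ≤ #J ∧
      (∀ α ∈ J, R ⊆ F α ∧ ∀ ξ ∈ R, f α ξ = g ξ) ∧
      ∀ ξ ∉ R, #{α | α ∈ J ∧ ξ ∈ F α} < θ := by
  classical
  let P : ℕ → Prop := fun k => ∃ R : Finset Λ, R.card = k ∧ θ ≤ #{α | α ∈ s ∧ R ⊆ F α}
  have hbound : ∀ k, P k → k ≤ n := by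
    rintro k ⟨R, rfl, hR⟩
    have : Nonempty {α | α ∈ s ∧ R ⊆ F α} := by
      rw [← mk_ne_zero_iff]
      exact (hθ.pos.trans_le hR).ne'
    obtain ⟨α, -, hα⟩ := this
    exact (Finset.card_le_card hα).trans (hF α)
  have hP0 : P 0 := ⟨∅, rfl, by simpa using hs⟩
  obtain ⟨R, hRcard, hR⟩ : P (Nat.findGreatest P n) := Nat.findGreatest_spec (Nat.zero_le n) hP0
  have hmax : ∀ ξ ∉ R, #{α | α ∈ s ∧ insert ξ R ⊆ F α} < θ := by
    intro ξ hξ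
    by_contra! h
    have hP : P (Nat.findGreatest P n + 1) :=
      ⟨insert ξ R, by rw [Finset.card_insert_of_notMem hξ, hRcard], h⟩
    have := Nat.le_findGreatest (hbound _ hP) hP
    omega
  obtain ⟨g, J, hJ, hJθ, hg⟩ := infinite_pigeonhole_set
    (fun α : {α | α ∈ s ∧ R ⊆ F α} => ULift.up.{u} fun ξ : R => f α ξ) θ hR hθ.aleph0_le
    (by rw [hθ.cof_ord]; exact (lt_aleph0_of_finite _).trans_le hθ.aleph0_le)
  refine ⟨R, fun ξ => if h : ξ ∈ R then g.down ⟨ξ, h⟩ else false, J, fun α hα => (hJ hα).1, hJθ,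
    fun α hα => ⟨(hJ hα).2, fun ξ hξ => ?_⟩, fun ξ hξ => (mk_le_mk_of_subset ?_).trans_lt (hmax ξ hξ)⟩
  · simp [hξ, ← hg hα]
  · rintro α ⟨hα, hξα⟩
    exact ⟨(hJ hα).1, Finset.insert_subset hξα (hJ hα).2⟩

/-- For regular `θ`, fewer than `θ` many coordinates outside the root of `exists_root` meet the
domains of fewer than `θ` many members. -/
theorem mk_setOf_meets_lt {ι Λ : Type u} {F : ι → Finset Λ} {J : Set ι} {R : Finset Λ}
    {θ : Cardinal.{u}} (hθ : θ.IsRegular) (hR : ∀ ξ ∉ R, #{α | α ∈ J ∧ ξ ∈ F α} < θ)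
    {W : Set Λ} (hW : #W < θ) : #{α | α ∈ J ∧ ∃ ξ ∈ W, ξ ∉ R ∧ ξ ∈ F α} < θ := by
  have h : #(⋃ ξ ∈ W \ (R : Set Λ), {α | α ∈ J ∧ ξ ∈ F α}) < θ :=
    (card_biUnion_lt_iff_forall_of_isRegular hθ
      ((mk_le_mk_of_subset sdiff_subset).trans_lt hW)).2 fun ξ hξ => hR ξ (by simpa using hξ.2)
  refine (mk_le_mk_of_subset ?_).trans_lt h
  rintro α ⟨hα, ξ, hξW, hξR, hξ⟩
  simp only [mem_iUnion]
  exact ⟨ξ, ⟨hξW, by simpa using hξR⟩, hα, hξ⟩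

theorem mk_biUnion_finset_lt {ι Λ : Type u} (F : ι → Finset Λ) {M : Set ι} {θ : Cardinal.{u}}
    (hθ : θ.IsRegular) (hM : #M < θ) : #(⋃ α ∈ M, (F α : Set Λ)) < θ :=
  (card_biUnion_lt_iff_forall_of_isRegular hθ hM).2 fun _ _ =>
    (lt_aleph0_of_finite _).trans_le hθ.aleph0_le

/-- If fewer than `θ` members of a set of size at least `θ` are excluded, one remains. -/
theorem exists_mem_notMem_of_mk_lt {ι : Type u} {J A B : Set ι} {θ : Cardinal.{u}} (hθ : ℵ₀ ≤ θ)
    (hJ : θ ≤ #J) (hA : #A < θ) (hB : #B < θ) : ∃ α ∈ J, α ∉ A ∧ α ∉ B := by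
  by_contra! h
  have hsub : J ⊆ A ∪ B := fun α hα => or_iff_not_imp_left.2 (h α hα)
  exact ((hJ.trans (mk_le_mk_of_subset hsub)).trans (mk_union_le A B)).not_gt (add_lt_of_lt hθ hA hB)

/-- Among `c`-many finite partial functions with domains of bounded size, `c` a singular cardinal
that is a limit of regular cardinals `d i`, there are `c` many with a common extension. -/
theorem exists_common_extension_of_card_le {ι Λ I : Type u} (F : ι → Finset Λ) (f : ι → Λ → Bool)
    (n : ℕ) (hF : ∀ α, (F α).card ≤ n) {c : Cardinal.{u}} (hcι : c ≤ #ι)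
    (hI : (#I).IsRegular) (hIc : #I < c) (d : I → Cardinal.{u}) (hd : ∀ i, (d i).IsRegular)
    (hdc : ∀ i, d i ≤ c) (hlim : ∀ θ < c, #{i | d i ≤ θ} < #I) :
    ∃ x : Λ → Bool, c ≤ #{α | ∀ ξ ∈ F α, f α ξ = x ξ} := by
  classical
  have hroot i := exists_root F f n hF univ (hd i) ((hdc i).trans (by simpa using hcι))
  choose R g J _ hJ hRJ hJR using hroot
  have hRn : ∀ i, (R i).card ≤ n := by
    intro i
    have : Nonempty (J i) := by
      rw [← mk_ne_zero_iff]
      exact ((hd i).pos.trans_le (hJ i)).ne'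
    obtain ⟨α, hα⟩ := this
    exact (Finset.card_le_card (hRJ i α hα).1).trans (hF α)
  obtain ⟨S, g₀, K, _, hK, hSK, hKS⟩ := exists_root R g n hRn univ hI (by simp)
  obtain ⟨K', hK'K, hK', hdisj⟩ := exists_pairwiseDisjoint_of_extend
    (fun i => (R i : Set Λ) \ S) K #I (by
      intro M hMK hM
      obtain ⟨i, hiK, hiM, hi⟩ := exists_mem_notMem_of_mk_lt hI.aleph0_le hK hM
        (mk_setOf_meets_lt hI hKS (mk_biUnion_finset_lt R hI hM))
      refine ⟨i, hiK, hiM, fun j hj => Set.disjoint_left.2 fun ξ hξi hξj => hi ⟨hiK, ξ, ?_⟩⟩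
      exact ⟨mem_biUnion hj hξj.1, by simpa using hξi.2, by simpa using hξi.1⟩)
  obtain ⟨x₀, hx₀⟩ : ∃ x₀ : Λ → Bool, ∀ i ∈ K', ∀ ξ ∈ R i, g i ξ = x₀ ξ := by
    refine ⟨fun ξ => if h : ∃ i ∈ K', ξ ∈ R i then g h.choose ξ else false, fun i hi ξ hξ => ?_⟩
    have h : ∃ i ∈ K', ξ ∈ R i := ⟨i, hi, hξ⟩
    simp only [dif_pos h]
    obtain ⟨hj, hξj⟩ := h.choose_spec
    by_cases hS : ξ ∈ S
    · rw [(hSK i (hK'K hi)).2 ξ hS, (hSK _ (hK'K hj)).2 ξ hS]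
    · rw [hdisj.elim_set hi hj ξ ⟨hξ, by simpa using hS⟩ ⟨hξj, by simpa using hS⟩]
  set W : Set Λ := ⋃ i, (R i : Set Λ) with hWdef
  have hW : #W ≤ #I := by
    refine (mk_iUnion_le _).trans ?_
    refine mul_le_of_le hI.aleph0_le le_rfl (ciSup_le' fun i => ?_)
    exact (lt_aleph0_of_finite _).le.trans hI.aleph0_le
  obtain ⟨M, hMJ, hM, hMdisj⟩ := exists_pairwiseDisjoint_of_extend
    (fun α => (F α : Set Λ) \ W) {α | ∀ ξ ∈ F α, ξ ∈ W → f α ξ = x₀ ξ} c (by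
      intro M hMJ hM
      obtain ⟨i, hiK, hi⟩ : ∃ i ∈ K', max #M #I < d i := by
        by_contra! h
        exact (hK'.trans (mk_le_mk_of_subset h)).not_gt (hlim _ (max_lt hM hIc))
      have hMi := (le_max_left _ _).trans_lt hi
      have hWi := hW.trans_lt ((le_max_right _ _).trans_lt hi)
      obtain ⟨α, hαJ, hαM, hα⟩ := exists_mem_notMem_of_mk_lt (hd i).aleph0_le (hJ i) hMi
        (mk_setOf_meets_lt (hd i) (hJR i) ((mk_union_le _ _).trans_lt
          (add_lt_of_lt (hd i).aleph0_le hWi (mk_biUnion_finset_lt F (hd i) hMi))))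
      refine ⟨α, fun ξ hξ hξW => ?_, hαM, fun β hβ => Set.disjoint_left.2 fun ξ hξα hξβ => ?_⟩
      · have hξR : ξ ∈ R i := by
          by_contra hξR
          exact hα ⟨hαJ, ξ, Or.inl hξW, hξR, hξ⟩
        rw [(hRJ i α hαJ).2 ξ hξR, hx₀ i hiK ξ hξR]
      · refine hα ⟨hαJ, ξ, Or.inr (mem_biUnion hβ hξβ.1), fun hξR => hξα.2 ?_, hξα.1⟩
        exact mem_iUnion.2 ⟨i, hξR⟩)
  refine ⟨fun ξ => if ξ ∈ W then x₀ ξ else if h : ∃ α ∈ M, ξ ∈ F α then f h.choose ξ else false,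
    hM.trans (mk_le_mk_of_subset fun α hα ξ hξ => ?_)⟩
  by_cases hξW : ξ ∈ W
  · simpa [hξW] using hMJ hα ξ hξ hξW
  · have h : ∃ α ∈ M, ξ ∈ F α := ⟨α, hα, hξ⟩
    obtain ⟨hβ, hξβ⟩ := h.choose_spec
    simp only [if_neg hξW, dif_pos h]
    rw [← hMdisj.elim_set hα hβ ξ ⟨hξ, hξW⟩ ⟨hξβ, hξW⟩]

/-- The limit of the `aleph` sequence at an ordinal of uncountable cofinality, if singular, is a
caliber of every Cantor cube. -/
theorem isCaliber_cube_aleph (Λ : Type u) {o : Ordinal.{u}} (ho : ℵ₀ < o.cof)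
    (hsing : o.cof < ℵ_ o) : IsCaliber (Λ → Bool) (ℵ_ o) := by
  classical
  intro ι U hι hUo hUne
  have hlim : Order.IsSuccLimit o := Ordinal.one_lt_cof_iff.1 (one_lt_aleph0.trans ho)
  have hcof : (ℵ_ o).ord.cof = o.cof := by rw [ord_aleph, Ordinal.cof_omega hlim]
  have hbasic : ∀ α, ∃ (F : Finset Λ) (f : Λ → Bool), ∀ y, (∀ ξ ∈ F, f ξ = y ξ) → y ∈ U α := by
    intro α
    obtain ⟨f, hf⟩ := hUne α
    obtain ⟨F, u, hu, hFu⟩ := isOpen_pi_iff.1 (hUo α) f hf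
    exact ⟨F, f, fun y hy => hFu fun ξ hξ => hy ξ hξ ▸ (hu ξ hξ).2⟩
  choose F f hFf using hbasic
  obtain ⟨n, hn⟩ := infinite_pigeonhole_card (fun α => ULift.up.{u} (F α).card) (ℵ_ o) hι.ge
    (aleph0_le_aleph o) (by rw [hcof]; simpa using ho)
  obtain ⟨s, hs, hstype⟩ := Ordinal.exists_ord_cof_eq o.ToType
  rw [Ordinal.cof_toType] at hstype
  have hsI : #s = o.cof := by
    have := congrArg Ordinal.card hstype
    simpa using this
  let e : o.ToType → Ordinal.{u} := Ordinal.typein (· < ·)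
  obtain ⟨x, hx⟩ := exists_common_extension_of_card_le
    (fun α : (fun α => ULift.up.{u} (F α).card) ⁻¹' {n} => F α) (fun α => f α) n.down
    (fun α => (congrArg ULift.down α.2).le) hn (I := s) (by rw [hsI]; exact isRegular_cof hlim)
    (by rwa [hsI]) (fun i => ℵ_ (e i + 1)) (fun i => isRegular_aleph_add_one _)
    (fun i => aleph_le_aleph.2 (hlim.add_one_lt (Ordinal.typein_lt_self _)).le) (by
      intro θ hθ
      obtain ⟨a, hao, hθa⟩ : ∃ a < o, θ < ℵ_ a := by
        rw [aleph_limit hlim] at hθ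
        obtain ⟨a, ha⟩ := exists_lt_of_lt_ciSup' hθ
        exact ⟨a, a.2, ha⟩
      obtain ⟨a, rfl⟩ : ∃ b, e b = a := by
        simpa [e] using Ordinal.mem_range_typein_iff (r := ((· < ·) : o.ToType → _ → _)) |>.2
          (by simpa using hao)
      obtain ⟨i, his, hai⟩ := hs a
      refine (mk_le_mk_of_subset (t := Iio ⟨i, his⟩) fun j hj => ?_).trans_lt
        (mk_Iio_lt _ (by rw [hsI, hstype]))
      by_contra hij
      have hij' : i ≤ j := not_lt.1 hij
      have hle : e a ≤ e j := Ordinal.typein_le_typein' _ |>.2 (hai.trans hij')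
      have h1 : ℵ_ (e a) ≤ ℵ_ (e j + 1) :=
        aleph_le_aleph.2 (hle.trans (le_add_of_nonneg_right zero_le_one))
      exact (hθa.trans_le (h1.trans hj)).false)
  refine ⟨{α | ∀ ξ ∈ F α, f α ξ = x ξ}, le_antisymm (hι ▸ mk_set_le _) (hx.trans ?_),
    x, mem_iInter₂.2 fun α hα => hFf α x hα⟩
  exact mk_le_of_injective (f := fun α => ⟨α.1.1, α.2⟩)
    fun α β h => Subtype.ext (Subtype.ext (by simpa using h))

/-- A Cantor cube of infinite weight `#Λ` has at most `2 ^ #Λ` open sets. -/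
theorem oCard_cube_le (Λ : Type u) [Infinite Λ] : oCard (Λ → Bool) ≤ 2 ^ #Λ := by
  classical
  have hcard : #(Finset (Λ × Bool)) = #Λ := by
    rw [mk_finset_of_infinite, mk_prod, lift_uzero, mk_bool, lift_ofNat]
    exact mul_eq_left (aleph0_le_mk Λ) ((natCast_le_aleph0 (n := 2)).trans (aleph0_le_mk Λ))
      two_ne_zero
  rw [← hcard, ← mk_set]
  refine mk_le_of_injective
    (f := fun U => {p : Finset (Λ × Bool) | ∀ y : Λ → Bool, (∀ q ∈ p, y q.1 = q.2) → y ∈ U.1}) ?_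
  have key : ∀ U V : Set (Λ → Bool), IsOpen U →
      {p : Finset (Λ × Bool) | ∀ y : Λ → Bool, (∀ q ∈ p, y q.1 = q.2) → y ∈ U} ⊆
        {p : Finset (Λ × Bool) | ∀ y : Λ → Bool, (∀ q ∈ p, y q.1 = q.2) → y ∈ V} → U ⊆ V := by
    intro U V hU hUV f hf
    obtain ⟨F, u, hu, hFu⟩ := isOpen_pi_iff.1 hU f hf
    refine hUV (a := F.image fun ξ => (ξ, f ξ)) (fun y hy => hFu fun ξ hξ => ?_) f (by simp)
    have : y ξ = f ξ := hy _ (Finset.mem_image_of_mem _ hξ)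
    exact this ▸ (hu ξ hξ).2
  rintro ⟨U, hU⟩ ⟨V, hV⟩ h
  exact Subtype.ext ((key U V hU h.subset).antisymm (key V U hV h.superset))

theorem oCard_sum_le (X Y : Type u) [TopologicalSpace X] [TopologicalSpace Y] :
    oCard (X ⊕ Y) ≤ 2 ^ #X * oCard Y := by
  rw [← mk_set, oCard, oCard, mul_def]
  refine mk_le_of_injective
    (f := fun U => (Sum.inl ⁻¹' U.1, ⟨Sum.inr ⁻¹' U.1, U.2.preimage continuous_inr⟩)) ?_
  intro U V h
  simp only [Prod.mk.injEq, Subtype.mk.injEq] at h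
  ext (x | y)
  · exact Set.ext_iff.1 h.1 x
  · exact Set.ext_iff.1 h.2 y

theorem mk_le_oCard (X : Type u) [TopologicalSpace X] [T1Space X] : #X ≤ oCard X :=
  mk_le_of_injective (f := fun x => ⟨{x}ᶜ, isOpen_compl_singleton⟩) fun x y h => by
    simpa using congrArg Subtype.val h

/-- A cardinal which is a caliber of `Y` and exceeds the number of subsets of `X` is a caliber*
of the disjoint sum of `X` and `Y`. -/
theorem IsCaliber.isCaliberStar_sum {X Y : Type u} [TopologicalSpace X] [TopologicalSpace Y]
    {c : Cardinal.{u}} (hY : IsCaliber Y c) (hc : ℵ₀ ≤ c) (hX : 2 ^ #X < c) :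
    IsCaliberStar (X ⊕ Y) c := by
  intro 𝒰 h𝒰 hopen hne
  set 𝒲 : Set (Set (X ⊕ Y)) := {U | U ∈ 𝒰 ∧ (Sum.inr ⁻¹' U : Set Y).Nonempty} with h𝒲
  have hrest : #(𝒰 \ 𝒲 : Set (Set (X ⊕ Y))) ≤ 2 ^ #X := by
    rw [← mk_set]
    refine mk_le_of_injective (f := fun U => (Sum.inl ⁻¹' U.1 : Set X)) ?_
    have hemp : ∀ U : (𝒰 \ 𝒲 : Set (Set (X ⊕ Y))), ∀ y, Sum.inr y ∉ U.1 :=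
      fun U y hy => U.2.2 ⟨U.2.1, y, hy⟩
    intro U V h
    ext (x | y)
    · exact Set.ext_iff.1 h x
    · exact iff_of_false (hemp U y) (hemp V y)
  have h𝒲c : #𝒲 = c := by
    refine le_antisymm (h𝒰 ▸ mk_le_mk_of_subset fun U hU => hU.1) ?_
    by_contra! hlt
    have hsub : 𝒰 ⊆ 𝒲 ∪ (𝒰 \ 𝒲) := fun U hU => by
      by_cases h : U ∈ 𝒲
      · exact Or.inl h
      · exact Or.inr ⟨hU, h⟩
    exact (h𝒰.ge.trans ((mk_le_mk_of_subset hsub).trans (mk_union_le _ _))).not_gt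
      (add_lt_of_lt hc hlt (hrest.trans_lt hX))
  obtain ⟨J, hJ, y, hy⟩ := hY (fun U : 𝒲 => (Sum.inr ⁻¹' U.1 : Set Y)) h𝒲c
    (fun U => (hopen _ U.2.1).preimage continuous_inr) (fun U => U.2.2)
  refine ⟨Subtype.val '' J, ?_, ?_, Sum.inr y, ?_⟩
  · rintro _ ⟨U, -, rfl⟩
    exact U.2.1
  · rw [mk_image_eq Subtype.val_injective, hJ]
  · rintro _ ⟨U, hU, rfl⟩
    exact mem_iInter₂.1 hy U hU

/-- A space with pairwise disjoint non-empty open sets indexed by a limit ordinal `o` does not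
have `ℵ_ o` as a weak precaliber. -/
theorem not_isWeakPrecaliber_aleph {X : Type u} [TopologicalSpace X] {o : Ordinal.{u}}
    (ho : Order.IsSuccLimit o) (V : o.ToType → Set X)
    (hV : ∀ i, IsOpen (V i)) (hne : ∀ i, (V i).Nonempty) (hdisj : Pairwise (Function.onFun Disjoint V)) :
    ¬ IsWeakPrecaliber X (ℵ_ o) := by
  intro h
  let e : o.ToType → Ordinal.{u} := Ordinal.typein (· < ·)
  have he : ∀ i, e i < o := fun i => Ordinal.typein_lt_self i
  have hcard : #(Σ i : o.ToType, (ℵ_ (e i)).ord.ToType) = ℵ_ o := by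
    simp only [mk_sigma, mk_ord_toType]
    apply le_antisymm
    · refine (sum_le_mk_mul_iSup _).trans (mul_le_of_le (aleph0_le_aleph o) ?_ ?_)
      · simpa using o.card_le_aleph
      · exact ciSup_le' fun i => aleph_le_aleph.2 (he i).le
    · rw [aleph_limit ho]
      refine ciSup_le' fun a => ?_
      obtain ⟨i, hi⟩ : ∃ b, e b = a := by
        simpa [e] using Ordinal.mem_range_typein_iff (r := ((· < ·) : o.ToType → _ → _)) |>.2
          (by simpa using mem_Iio.1 a.2)
      rw [← hi]
      exact le_sum (fun i => ℵ_ (e i)) i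
  obtain ⟨J, hJ, hlink⟩ := h (fun p : Σ i : o.ToType, (ℵ_ (e i)).ord.ToType => V p.1) hcard
    (fun p => hV _) (fun p => hne _)
  have hfst : ∀ p ∈ J, ∀ q ∈ J, p.1 = q.1 := by
    intro p hp q hq
    by_contra hpq
    exact (hlink p hp q hq).ne_empty (hdisj hpq).inter_eq
  obtain ⟨p, hp⟩ : J.Nonempty := by
    rw [← nonempty_coe_sort, ← mk_ne_zero_iff, hJ]
    exact (aleph_pos o).ne'
  have hle : #J ≤ ℵ_ (e p.1) := by
    rw [← mk_ord_toType (ℵ_ (e p.1))]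
    refine (mk_le_mk_of_subset (t := range (Sigma.mk p.1)) ?_).trans mk_range_le
    rintro ⟨i, z⟩ hq
    obtain rfl : i = p.1 := hfst _ hq _ hp
    exact mem_range_self z
  exact (hle.trans_lt (aleph_lt_aleph.2 (he p.1))).ne hJ

theorem not_isWeakPrecaliberStar_of_pairwise_disjoint {X D : Type u} [TopologicalSpace X]
    (hD : 1 < #D) (V : D → Set X) (hV : ∀ i, IsOpen (V i))
    (hne : ∀ i, (V i).Nonempty) (hdisj : Pairwise (Function.onFun Disjoint V)) :
    ¬ IsWeakPrecaliberStar X #D := by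
  intro h
  have hinj : Function.Injective V := fun i j hij => by
    by_contra hne'
    have := hdisj hne'
    simp only [Function.onFun, hij, disjoint_self, Set.bot_eq_empty] at this
    exact (hne j).ne_empty this
  obtain ⟨𝒱, h𝒱, hcard, hlink⟩ := h (range V) (mk_range_eq V hinj)
    (forall_mem_range.2 hV) (forall_mem_range.2 hne)
  have : Subsingleton 𝒱 := by
    refine ⟨fun ⟨U, hU⟩ ⟨W, hW⟩ => Subtype.ext ?_⟩
    obtain ⟨i, rfl⟩ := h𝒱 hU
    obtain ⟨j, rfl⟩ := h𝒱 hW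
    by_contra hij
    exact (hlink _ hU _ hW).ne_empty (hdisj fun h => hij (congrArg V h)).inter_eq
  exact (hcard ▸ hD).not_ge (le_one_iff_subsingleton.2 this)

theorem stmt6 (κ : Cardinal.{u}) (hκ : ℵ₀ ≤ κ)
    (h1 : 2 ^ κ < Cardinal.aleph κ.ord) (h2 : ℵ₀ < κ.ord.cof) :
    ∃ (X : Type u) (_ : TopologicalSpace X),
      CompactSpace X ∧ T2Space X ∧
      oCard X = 2 ^ Cardinal.aleph κ.ord ∧ #X = 2 ^ Cardinal.aleph κ.ord ∧
      IsCaliberStar X (Cardinal.aleph κ.ord) ∧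
      ¬ IsWeakPrecaliber X (Cardinal.aleph κ.ord) ∧
      ¬ IsWeakPrecaliberStar X κ := by
  let _ : TopologicalSpace κ.ord.ToType := ⊥
  have : DiscreteTopology κ.ord.ToType := ⟨rfl⟩
  let Λ : Type u := (ℵ_ κ.ord).ord.ToType
  have hΛ : #Λ = ℵ_ κ.ord := mk_ord_toType _
  have : Infinite Λ := infinite_iff.2 (hΛ ▸ aleph0_le_aleph _)
  have hY : #(OnePoint κ.ord.ToType) = κ := by
    have : #(OnePoint κ.ord.ToType) = #κ.ord.ToType + 1 := mk_option
    rw [this, mk_ord_toType, add_one_eq hκ]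
  have hZ : #(Λ → Bool) = 2 ^ ℵ_ κ.ord := by simp [hΛ]
  have hpow : (2 : Cardinal.{u}) ^ κ ≤ 2 ^ ℵ_ κ.ord := h1.le.trans (cantor _).le
  have hinf : ℵ₀ ≤ (2 : Cardinal.{u}) ^ ℵ_ κ.ord := (aleph0_le_aleph _).trans (cantor _).le
  have hlim : Order.IsSuccLimit κ.ord := Ordinal.one_lt_cof_iff.1 (one_lt_aleph0.trans h2)
  have hX : #(OnePoint κ.ord.ToType ⊕ (Λ → Bool)) = 2 ^ ℵ_ κ.ord := by
    rw [mk_sum, lift_id, lift_id, hY, hZ]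
    exact add_eq_right hinf ((cantor κ).le.trans hpow)
  let V : κ.ord.ToType → Set (OnePoint κ.ord.ToType ⊕ (Λ → Bool)) := fun i =>
    {Sum.inl (i : OnePoint _)}
  have hV : ∀ i, IsOpen (V i) := by
    intro i
    have := isOpenMap_inl (X := OnePoint κ.ord.ToType) (Y := Λ → Bool) _
      (OnePoint.isOpenEmbedding_coe.isOpenMap _ (isOpen_discrete {i}))
    simpa [V] using this
  have hne : ∀ i, (V i).Nonempty := fun i => singleton_nonempty _
  have hdisj : Pairwise (Function.onFun Disjoint V) := fun i j hij => by simpa [V, Function.onFun] using hij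
  refine ⟨OnePoint κ.ord.ToType ⊕ (Λ → Bool), inferInstance, inferInstance, inferInstance,
    le_antisymm ?_ (hX.ge.trans (mk_le_oCard _)), hX, ?_,
    not_isWeakPrecaliber_aleph hlim V hV hne hdisj, ?_⟩
  · refine (oCard_sum_le _ _).trans (mul_le_of_le hinf (by rwa [hY]) ?_)
    simpa only [hΛ] using oCard_cube_le Λ
  · refine IsCaliber.isCaliberStar_sum (isCaliber_cube_aleph Λ h2 ?_) (aleph0_le_aleph _)
      (by rwa [hY])
    exact ((Ordinal.cof_ord_le κ).trans (cantor κ).le).trans_lt h1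
  · have := not_isWeakPrecaliberStar_of_pairwise_disjoint (D := κ.ord.ToType)
      (by rw [mk_ord_toType]; exact one_lt_aleph0.trans_le hκ) V hV hne hdisj
    rwa [mk_ord_toType] at this
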